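/- Let α = b^{e_0} a b^{e_1} a ⋯ b^{e_s} a b^{e_{s+1}} and β = b^{f_0} a b^{f_1} a ⋯ b^{f_t} a b^{f_{t+1}} be elements of Λ written in form (L), i.e., with e_μ ∈ [0, d) for μ ≤ s and f_ν ∈ [0, d) for ν ≤ t. Then αΛ ∩ βΛ ≠ ∅ if and only if e_μ = f_μ for all μ ≤ min{s, t}. In that case there exists γ ∈ Λ with αΛ ∩ βΛ = γΛ (α and β have a unique minimal common extension); in particular, Λ is a finitely aligned category of paths. -/

import Mathlib

inductive BSGen : Type
  | a : BSGen
  | b : BSGen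

/-- The relations for the Baumslag–Solitar presentation `⟨a, b | a bᶜ = bᵉ a⟩`.
For cases (BS1), (BS2) take `e = d`; for case (BS3) take `e = -d`. -/
def BSRel (c e : ℤ) : Set (FreeGroup BSGen) :=
  {FreeGroup.of BSGen.a * FreeGroup.of BSGen.b ^ c *
    (FreeGroup.of BSGen.b ^ e * FreeGroup.of BSGen.a)⁻¹}

/-- The Baumslag–Solitar group `Γ = ⟨a, b | a bᶜ = bᵉ a⟩`. -/
abbrev BSGroup (c e : ℤ) := PresentedGroup (BSRel c e)

/-- The generator `a` of `Γ`. -/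
def bsa (c e : ℤ) : BSGroup c e := PresentedGroup.of BSGen.a

/-- The generator `b` of `Γ`. -/
def bsb (c e : ℤ) : BSGroup c e := PresentedGroup.of BSGen.b

/-- `Λ`, the submonoid of `Γ` generated by `a` and `b`. -/
def bsΛ (c e : ℤ) : Submonoid (BSGroup c e) :=
  Submonoid.closure {bsa c e, bsb c e}

namespace HNNExtension

variable {A B : Subgroup (Multiplicative ℤ)} (φ : A ≃* B)

/-- A product of blocks `g * t` followed by an element of the base group is represented by a
reduced word all of whose stable letters have exponent `1`. -/
theorem exists_reducedWord_of_positive (es : List ℤ) (p : ℤ) :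
    ∃ w : NormalWord.ReducedWord (Multiplicative ℤ) A B,
      w.prod φ = (es.map fun m => of (Multiplicative.ofAdd m) * t).prod *
        of (Multiplicative.ofAdd p) ∧
      (∀ x ∈ w.toList, x.1 = 1) ∧ w.toList.length = es.length ∧
      w.head = Multiplicative.ofAdd (es.headD p) := by
  induction es with
  | nil =>
    exact ⟨⟨Multiplicative.ofAdd p, [], List.isChain_nil⟩, by simp [NormalWord.ReducedWord.prod]⟩
  | cons m es ih =>
    obtain ⟨w, hprod, hone, hlen, -⟩ := ih
    refine ⟨⟨Multiplicative.ofAdd m, (1, w.head) :: w.toList, ?_⟩, ?_, ?_, ?_, ?_⟩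
    · exact List.isChain_cons.2 ⟨fun y hy _ => (hone y (List.mem_of_mem_head? hy)).symm, w.chain⟩
    · rw [List.map_cons, List.prod_cons, mul_assoc _ _ (of (Multiplicative.ofAdd p)), ← hprod]
      simp [NormalWord.ReducedWord.prod, mul_assoc]
    · simpa using hone
    · simpa using hlen
    · simp

/-- Uniqueness of the normal form of positive words, when the digits are pairwise incongruent
modulo the associated subgroup `B`. -/
theorem positive_normalForm_unique {S : Set ℤ}
    (hS : ∀ m ∈ S, ∀ n ∈ S, (Multiplicative.ofAdd m)⁻¹ * Multiplicative.ofAdd n ∈ B → m = n)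
    {es fs : List ℤ} {p q : ℤ} (hes : ∀ m ∈ es, m ∈ S) (hfs : ∀ m ∈ fs, m ∈ S)
    (h : (es.map fun m => of (Multiplicative.ofAdd m) * t).prod * of (Multiplicative.ofAdd p) =
      ((fs.map fun m => of (Multiplicative.ofAdd m) * t).prod * of (Multiplicative.ofAdd q) :
        HNNExtension (Multiplicative ℤ) A B φ)) :
    es = fs ∧ p = q := by
  induction es generalizing fs with
  | nil =>
    cases fs with
    | nil => exact ⟨rfl, Multiplicative.ofAdd.injective (of_injective φ (by simpa using h))⟩
    | cons n fs =>
      obtain ⟨w, hw, -, hwl, -⟩ := exists_reducedWord_of_positive φ [] p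
      obtain ⟨v, hv, -, hvl, -⟩ := exists_reducedWord_of_positive φ (n :: fs) q
      have := congrArg List.length
        (ReducedWord.map_fst_eq_and_of_prod_eq φ (hw.trans (h.trans hv.symm))).1
      simp [hwl, hvl] at this
  | cons m es ih =>
    obtain ⟨w, hw, hw1, hwl, hwh⟩ := exists_reducedWord_of_positive φ (m :: es) p
    obtain ⟨v, hv, -, hvl, hvh⟩ := exists_reducedWord_of_positive φ fs q
    obtain ⟨hmap, hhead⟩ :=
      ReducedWord.map_fst_eq_and_of_prod_eq φ (hw.trans (h.trans hv.symm))
    cases fs with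
    | nil =>
      have := congrArg List.length hmap
      simp [hwl, hvl] at this
    | cons n fs =>
      have hmem : w.head⁻¹ * v.head ∈ B := by
        refine hhead 1 ?_
        cases hl : w.toList with
        | nil => simp [hl] at hwl
        | cons x l => simp [hw1 x (by simp [hl])]
      rw [hwh, hvh] at hmem
      obtain rfl : m = n := hS m (hes m (by simp)) n (hfs n (by simp)) (by simpa using hmem)
      obtain ⟨rfl, rfl⟩ := ih (fs := fs) (fun k hk => hes k (by simp [hk]))
        (fun k hk => hfs k (by simp [hk])) (by simpa [mul_assoc] using h)
      exact ⟨rfl, rfl⟩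

end HNNExtension

section BaumslagSolitar

variable {c e : ℤ}

theorem bsa_mul_bsb_zpow (c e : ℤ) :
    bsa c e * bsb c e ^ c = bsb c e ^ e * bsa c e := by
  have h : PresentedGroup.mk (BSRel c e) (FreeGroup.of BSGen.a * FreeGroup.of BSGen.b ^ c *
      (FreeGroup.of BSGen.b ^ e * FreeGroup.of BSGen.a)⁻¹) = 1 :=
    PresentedGroup.one_of_mem rfl
  rw [map_mul, map_inv, mul_inv_eq_one] at h
  simp only [map_mul, map_zpow] at h
  exact h

theorem bsb_zpow_mul_bsa (c e k : ℤ) :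
    bsb c e ^ (e * k) * bsa c e = bsa c e * bsb c e ^ (c * k) := by
  have h : SemiconjBy (bsa c e) (bsb c e ^ c) (bsb c e ^ e) := bsa_mul_bsb_zpow c e
  simpa [zpow_mul] using (h.zpow_right k).eq.symm

/-- The word `b^{m₀} a b^{m₁} a ⋯ b^{m_{k-1}} a` with the given list of exponents. -/
def bsWord (c e : ℤ) (es : List ℤ) : BSGroup c e :=
  (es.map fun m => bsb c e ^ m * bsa c e).prod

@[simp]
theorem bsWord_nil : bsWord c e [] = 1 := rfl

@[simp]
theorem bsWord_cons (m : ℤ) (es : List ℤ) :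
    bsWord c e (m :: es) = bsb c e ^ m * bsa c e * bsWord c e es := by
  simp [bsWord]

@[simp]
theorem bsWord_append (es fs : List ℤ) :
    bsWord c e (es ++ fs) = bsWord c e es * bsWord c e fs := by
  simp [bsWord]

theorem bsa_mem : bsa c e ∈ bsΛ c e := Submonoid.subset_closure (by simp)

theorem bsb_mem : bsb c e ∈ bsΛ c e := Submonoid.subset_closure (by simp)

theorem bsb_zpow_mem {k : ℤ} (hk : 0 ≤ k) : bsb c e ^ k ∈ bsΛ c e := by
  lift k to ℕ using hk
  simpa using pow_mem bsb_mem k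

theorem bsWord_mem {es : List ℤ} (hes : ∀ m ∈ es, 0 ≤ m) : bsWord c e es ∈ bsΛ c e := by
  refine list_prod_mem fun x hx => ?_
  obtain ⟨m, hm, rfl⟩ := List.mem_map.1 hx
  exact mul_mem (bsb_zpow_mem (hes m hm)) bsa_mem

/-- Uniqueness of the form (L). -/
theorem bsWord_mul_zpow_inj (hc : c ≠ 0) (he : e ≠ 0) {es fs : List ℤ} {p q : ℤ}
    (hes : ∀ m ∈ es, 0 ≤ m ∧ m < |e|) (hfs : ∀ m ∈ fs, 0 ≤ m ∧ m < |e|)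
    (h : bsWord c e es * bsb c e ^ p = bsWord c e fs * bsb c e ^ q) : es = fs ∧ p = q := by
  have hinj {k : ℤ} (hk : k ≠ 0) : Function.Injective (zpowGroupHom (α := Multiplicative ℤ) k) :=
    fun x y hxy => by
      apply Multiplicative.toAdd.injective
      simpa [hk] using congrArg Multiplicative.toAdd hxy
  let φ := (MonoidHom.ofInjective (hinj hc)).symm.trans (MonoidHom.ofInjective (hinj he))
  have hφ (x : Multiplicative ℤ) :
      (HNNExtension.t * HNNExtension.of (x ^ c) : HNNExtension _ _ _ φ) =
        HNNExtension.of (x ^ e) * HNNExtension.t := by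
    have := HNNExtension.t_mul_of (φ := φ) (MonoidHom.ofInjective (hinj hc) x)
    simpa [φ, MonoidHom.ofInjective_apply] using this
  let g : BSGen → HNNExtension _ _ _ φ := fun
    | .a => HNNExtension.t
    | .b => HNNExtension.of (Multiplicative.ofAdd 1)
  have hg : ∀ r ∈ BSRel c e, FreeGroup.lift g r = 1 := by
    rintro r rfl
    rw [map_mul, map_inv, mul_inv_eq_one]
    simpa [g] using hφ (Multiplicative.ofAdd 1)
  let f : BSGroup c e →* HNNExtension _ _ _ φ := PresentedGroup.toGroup hg
  have hfa : f (bsa c e) = HNNExtension.t := PresentedGroup.toGroup.of hg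
  have hfb (k : ℤ) : f (bsb c e ^ k) = HNNExtension.of (Multiplicative.ofAdd k) := by
    have : f (bsb c e) = HNNExtension.of (Multiplicative.ofAdd 1) := PresentedGroup.toGroup.of hg
    rw [map_zpow, this, ← map_zpow, ← ofAdd_zsmul, smul_eq_mul, mul_one]
  have hfw (l : List ℤ) : f (bsWord c e l) =
      (l.map fun m => HNNExtension.of (Multiplicative.ofAdd m) * HNNExtension.t).prod := by
    rw [bsWord, map_list_prod, List.map_map]
    congr 2
    funext m
    simp [hfa, ← hfb]
  refine HNNExtension.positive_normalForm_unique φ (S := {m | 0 ≤ m ∧ m < |e|}) ?_ hes hfs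
    (by simpa [hfw, hfb, -map_zpow] using congrArg f h)
  rintro m ⟨hm0, hm⟩ n ⟨hn0, hn⟩ ⟨x, hx⟩
  have hdvd : e ∣ n - m := by
    refine ⟨x.toAdd, ?_⟩
    have := congrArg Multiplicative.toAdd hx
    simp at this
    linarith
  have := Int.eq_zero_of_abs_lt_dvd ((abs_dvd e _).2 hdvd) (by rw [abs_lt]; constructor <;> linarith)
  linarith

/-- Left multiplication by a power of `b` preserves the form (L) and the number of letters `a`. -/
theorem exists_zpow_mul_bsWord (hc : 0 < c) (he : e ≠ 0) (es : List ℤ) (j p : ℤ) :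
    ∃ fs : List ℤ, ∃ q : ℤ, (∀ m ∈ fs, 0 ≤ m ∧ m < |e|) ∧ fs.length = es.length ∧
      bsb c e ^ j * (bsWord c e es * bsb c e ^ p) = bsWord c e fs * bsb c e ^ q ∧
      (0 < e → (∀ m ∈ es, 0 ≤ m) → 0 ≤ j → 0 ≤ p → 0 ≤ q) := by
  induction es generalizing j with
  | nil => exact ⟨[], j + p, by simp, rfl, by simp [zpow_add], fun _ _ => add_nonneg⟩
  | cons m es ih =>
    obtain ⟨fs, q, hfs, hlen, hprod, hq⟩ := ih (c * ((j + m) / e))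
    refine ⟨(j + m) % e :: fs, q, ?_, by simp [hlen], ?_, ?_⟩
    · simpa using ⟨⟨Int.emod_nonneg _ he, Int.emod_lt_abs _ he⟩, hfs⟩
    · have hdiv : bsb c e ^ j * bsb c e ^ m =
          bsb c e ^ ((j + m) % e) * bsb c e ^ (e * ((j + m) / e)) := by
        rw [← zpow_add, ← zpow_add, Int.emod_add_mul_ediv]
      calc bsb c e ^ j * (bsWord c e (m :: es) * bsb c e ^ p)
          = bsb c e ^ j * bsb c e ^ m * bsa c e * (bsWord c e es * bsb c e ^ p) := by
            simp [mul_assoc]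
        _ = bsb c e ^ ((j + m) % e) * bsa c e *
              (bsb c e ^ (c * ((j + m) / e)) * (bsWord c e es * bsb c e ^ p)) := by
            rw [hdiv, mul_assoc _ _ (bsa c e), bsb_zpow_mul_bsa]
            simp only [mul_assoc]
        _ = bsWord c e ((j + m) % e :: fs) * bsb c e ^ q := by
            rw [hprod]
            simp [mul_assoc]
    · intro hpos hes hj hp
      simp only [List.mem_cons, forall_eq_or_imp] at hes
      exact hq hpos hes.2
        (mul_nonneg hc.le (Int.ediv_nonneg (add_nonneg hj hes.1) hpos.le)) hp

/-- Every element of `Λ` has a form (L), with nonnegative last exponent if `e > 0`. -/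
theorem exists_bsWord_of_mem (hc : 0 < c) (he : e ≠ 0) {x : BSGroup c e} (hx : x ∈ bsΛ c e) :
    ∃ es : List ℤ, ∃ p : ℤ, (∀ m ∈ es, 0 ≤ m ∧ m < |e|) ∧
      x = bsWord c e es * bsb c e ^ p ∧ (0 < e → 0 ≤ p) := by
  induction hx using Submonoid.closure_induction_left with
  | one => exact ⟨[], 0, by simp⟩
  | mul_left y hy z _ ih =>
    obtain ⟨es, p, hes, rfl, hp⟩ := ih
    rcases hy with rfl | rfl
    · exact ⟨0 :: es, p, by simpa [he] using hes, by simp [mul_assoc], hp⟩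
    · obtain ⟨fs, q, hfs, -, hprod, hq⟩ := exists_zpow_mul_bsWord hc he es 1 p
      exact ⟨fs, q, hfs, by simpa using hprod,
        fun h => hq h (fun m hm => (hes m hm).1) zero_le_one (hp h)⟩

/-- If `e < 0`, every form (L) containing at least one `a` lies in `Λ`. -/
theorem bsWord_mul_zpow_mem_of_neg (hc : 0 < c) (he : e < 0) {es : List ℤ} (hne : es ≠ [])
    (hes : ∀ m ∈ es, 0 ≤ m) (p : ℤ) : bsWord c e es * bsb c e ^ p ∈ bsΛ c e := by
  rcases le_or_gt 0 p with hp | hp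
  · exact mul_mem (bsWord_mem hes) (bsb_zpow_mem hp)
  obtain ⟨fs, m, rfl⟩ := List.eq_nil_or_concat' es |>.resolve_left hne
  have key : bsWord c e (fs ++ [m]) * bsb c e ^ p =
      bsWord c e fs * (bsb c e ^ m * (bsb c e ^ (e * p) * bsa c e * bsb c e ^ (p - c * p))) := by
    rw [bsb_zpow_mul_bsa, mul_assoc (bsa c e), ← zpow_add, add_sub_cancel]
    simp [mul_assoc]
  rw [key]
  refine mul_mem (bsWord_mem fun k hk => hes k (by simp [hk])) (mul_mem (bsb_zpow_mem
    (hes m (by simp))) (mul_mem (mul_mem (bsb_zpow_mem ?_) bsa_mem) (bsb_zpow_mem ?_)))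
  · exact mul_nonneg_of_nonpos_of_nonpos he.le hp.le
  · nlinarith

/-- If `e > 0` and `w b^q y` lies in `Λ`, with `y ∈ Λ`, then so does `b^q y`. -/
theorem zpow_mul_mem_of_bsWord_mul_mem (hc : 0 < c) (he : 0 < e) {ws : List ℤ}
    (hws : ∀ m ∈ ws, 0 ≤ m ∧ m < |e|) {q : ℤ} {y : BSGroup c e} (hy : y ∈ bsΛ c e)
    (h : bsWord c e ws * (bsb c e ^ q * y) ∈ bsΛ c e) : bsb c e ^ q * y ∈ bsΛ c e := by
  obtain ⟨es, p, -, rfl, -⟩ := exists_bsWord_of_mem hc he.ne' hy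
  obtain ⟨fs, r, hfs, -, hprod, -⟩ := exists_zpow_mul_bsWord hc he.ne' es q p
  rw [hprod] at h ⊢
  obtain ⟨gs, n, hgs, hgn, hn⟩ := exists_bsWord_of_mem hc he.ne' h
  rw [← mul_assoc, ← bsWord_append] at hgn
  obtain ⟨-, rfl⟩ := bsWord_mul_zpow_inj hc.ne' he.ne'
    (by simpa [or_imp, forall_and] using ⟨⟨fun m hm => (hws m hm).1, fun m hm => (hfs m hm).1⟩,
      fun m hm => (hws m hm).2, fun m hm => (hfs m hm).2⟩) hgs hgn
  exact mul_mem (bsWord_mem fun m hm => (hfs m hm).1) (bsb_zpow_mem (hn he))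

/-- The minimal common extension of two elements of `Λ` whose forms (L) are comparable. -/
theorem exists_minimal_common_extension (hc : 0 < c) (he : e ≠ 0) (es gs : List ℤ) (p q : ℤ)
    {α β : BSGroup c e} (hα : α = bsWord c e es * bsb c e ^ p)
    (hβ : β = bsWord c e (es ++ gs) * bsb c e ^ q) (hβΛ : β ∈ bsΛ c e) :
    ∃ γ ∈ bsΛ c e, ∀ x : BSGroup c e,
      ((∃ δ ∈ bsΛ c e, x = α * δ) ∧ (∃ δ ∈ bsΛ c e, x = β * δ)) ↔
      ∃ δ ∈ bsΛ c e, x = γ * δ := by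
  obtain ⟨ws, r, hws, hlen, hprod, -⟩ := exists_zpow_mul_bsWord hc he gs (-p) q
  have hβα : β = α * (bsWord c e ws * bsb c e ^ r) := by
    rw [← hprod, hα, hβ, bsWord_append]
    simp [mul_assoc]
  by_cases hmem : bsWord c e ws * bsb c e ^ r ∈ bsΛ c e
  · refine ⟨β, hβΛ, fun x => ⟨And.right, ?_⟩⟩
    rintro ⟨δ, hδ, rfl⟩
    exact ⟨⟨_, mul_mem hmem hδ, by rw [hβα, mul_assoc]⟩, δ, hδ, rfl⟩
  have hwsΛ : bsWord c e ws ∈ bsΛ c e := bsWord_mem fun m hm => (hws m hm).1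
  have hr : r < 0 := by
    by_contra! hr
    exact hmem (mul_mem hwsΛ (bsb_zpow_mem hr))
  have hrΛ : bsb c e ^ (-r) ∈ bsΛ c e := bsb_zpow_mem (by linarith)
  have hγ : α * bsWord c e ws = β * bsb c e ^ (-r) := by
    rw [hβα]
    simp [mul_assoc]
  refine ⟨α * bsWord c e ws, hγ ▸ mul_mem hβΛ hrΛ, fun x => ⟨?_, ?_⟩⟩
  · rintro ⟨⟨δ, hδ, rfl⟩, δ', hδ', h⟩
    have hδ_eq : δ = bsWord c e ws * (bsb c e ^ r * δ') := by
      apply mul_left_cancel (a := α)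
      rw [h, hβα]
      simp only [mul_assoc]
    refine ⟨bsb c e ^ r * δ', ?_, by rw [hδ_eq, mul_assoc]⟩
    rcases he.lt_or_gt with hneg | hpos
    · have hnil : ws = [] := by
        by_contra hne
        exact hmem (bsWord_mul_zpow_mem_of_neg hc hneg hne (fun m hm => (hws m hm).1) r)
      simpa [hnil, hδ_eq] using hδ
    · exact zpow_mul_mem_of_bsWord_mul_mem hc hpos hws hδ' (hδ_eq ▸ hδ)
  · rintro ⟨δ, hδ, rfl⟩
    exact ⟨⟨_, mul_mem hwsΛ hδ, mul_assoc _ _ _⟩, _, mul_mem hrΛ hδ, by rw [hγ, mul_assoc]⟩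

/-- A right multiple by an element of `Λ` of an element with a form (L) has a form (L) extending
it. -/
theorem exists_bsWord_mul_of_mem (hc : 0 < c) (he : e ≠ 0) (es : List ℤ) (p : ℤ)
    {δ : BSGroup c e} (hδ : δ ∈ bsΛ c e) :
    ∃ gs : List ℤ, ∃ q : ℤ, (∀ m ∈ gs, 0 ≤ m ∧ m < |e|) ∧
      bsWord c e es * bsb c e ^ p * δ = bsWord c e (es ++ gs) * bsb c e ^ q := by
  obtain ⟨fs, r, -, rfl, -⟩ := exists_bsWord_of_mem hc he hδ
  obtain ⟨gs, q, hgs, -, hprod, -⟩ := exists_zpow_mul_bsWord hc he fs p r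
  exact ⟨gs, q, hgs, by rw [mul_assoc, hprod, bsWord_append, mul_assoc]⟩

end BaumslagSolitar

/-- Let `α = b^{e₀} a ⋯ b^{e_s} a b^{e_{s+1}}` and `β = b^{f₀} a ⋯ b^{f_t} a b^{f_{t+1}}`
be elements of `Λ` in form (L) (entries of `es`, `fs` in `[0,d)`).  Then
`αΛ ∩ βΛ ≠ ∅` iff `e_μ = f_μ` for all `μ ≤ min{s,t}`; and in that case `α` and `β` have a
unique minimal common extension `γ`, i.e. `αΛ ∩ βΛ = γΛ` (in particular `Λ` is finitely
aligned). -/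
theorem statement9 (c d : ℤ) (hc : 0 < c) (hd : 0 < d) (e : ℤ) (he : e = d ∨ e = -d)
    (es fs : List ℤ) (p q : ℤ) (hes : es ≠ []) (hfs : fs ≠ [])
    (hesb : ∀ m ∈ es, 0 ≤ m ∧ m < d) (hfsb : ∀ m ∈ fs, 0 ≤ m ∧ m < d)
    (α β : BSGroup c e)
    (hα : α = (es.map (fun m => bsb c e ^ m * bsa c e)).prod * bsb c e ^ p)
    (hβ : β = (fs.map (fun m => bsb c e ^ m * bsa c e)).prod * bsb c e ^ q)
    (hαΛ : α ∈ bsΛ c e) (hβΛ : β ∈ bsΛ c e) :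
    ((∃ x : BSGroup c e,
        (∃ γ ∈ bsΛ c e, x = α * γ) ∧ (∃ γ ∈ bsΛ c e, x = β * γ)) ↔
      (∀ (μ : ℕ) (h1 : μ < es.length) (h2 : μ < fs.length), es[μ] = fs[μ])) ∧
    ((∀ (μ : ℕ) (h1 : μ < es.length) (h2 : μ < fs.length), es[μ] = fs[μ]) →
      ∃ γ ∈ bsΛ c e, ∀ x : BSGroup c e,
        ((∃ δ ∈ bsΛ c e, x = α * δ) ∧ (∃ δ ∈ bsΛ c e, x = β * δ)) ↔
        ∃ δ ∈ bsΛ c e, x = γ * δ) := by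
  have he0 : e ≠ 0 := by rcases he with rfl | rfl <;> simp [hd.ne']
  have habs : |e| = d := by rcases he with rfl | rfl <;> simp [hd.le]
  subst habs
  have hmce : (∀ (μ : ℕ) (h1 : μ < es.length) (h2 : μ < fs.length), es[μ] = fs[μ]) →
      ∃ γ ∈ bsΛ c e, ∀ x : BSGroup c e,
        ((∃ δ ∈ bsΛ c e, x = α * δ) ∧ (∃ δ ∈ bsΛ c e, x = β * δ)) ↔
        ∃ δ ∈ bsΛ c e, x = γ * δ := by
    intro h
    rcases le_total es.length fs.length with hle | hle
    · obtain ⟨gs, rfl⟩ := List.prefix_iff_getElem.2 ⟨hle, fun i hi => h i hi (hi.trans_le hle)⟩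
      exact exists_minimal_common_extension hc he0 es gs p q hα hβ hβΛ
    · obtain ⟨gs, rfl⟩ :=
        List.prefix_iff_getElem.2 ⟨hle, fun i hi => (h i (hi.trans_le hle) hi).symm⟩
      obtain ⟨γ, hγ, hiff⟩ := exists_minimal_common_extension hc he0 fs gs q p hβ hα hαΛ
      exact ⟨γ, hγ, fun x => and_comm.trans (hiff x)⟩
  refine ⟨⟨?_, fun h => ?_⟩, hmce⟩
  · rintro ⟨x, ⟨γ, hγ, hxα⟩, δ, hδ, hxβ⟩ μ h1 h2
    obtain ⟨gs, r, hgs, hαγ⟩ := exists_bsWord_mul_of_mem hc he0 es p hγ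
    obtain ⟨ks, s, hks, hβδ⟩ := exists_bsWord_mul_of_mem hc he0 fs q hδ
    have heq : bsWord c e (es ++ gs) * bsb c e ^ r = bsWord c e (fs ++ ks) * bsb c e ^ s := by
      rw [← hαγ, ← hβδ]
      exact (hα ▸ hxα).symm.trans (hβ ▸ hxβ)
    have hlist := (bsWord_mul_zpow_inj hc.ne' he0
      (fun m hm => (List.mem_append.1 hm).elim (hesb m) (hgs m))
      (fun m hm => (List.mem_append.1 hm).elim (hfsb m) (hks m)) heq).1
    have hget : (es ++ gs)[μ]? = (fs ++ ks)[μ]? := by rw [hlist]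
    simpa [List.getElem?_append_left, h1, h2] using hget
  · obtain ⟨γ, -, hiff⟩ := hmce h
    exact ⟨γ, (hiff γ).2 ⟨1, one_mem _, (mul_one γ).symm⟩⟩
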